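/- Assume hypothesis (𝓕) and that ∫_ℝ K(s) e^{−zs} ds is finite exactly for z in a maximal open interval (a,b) containing 0, and define χ₁(z,c) := z² − cz − f'(0) + g'(0) e^{−zch} ∫_ℝ K(s) e^{−zs} ds with critical speeds c⁻* < c⁺* (χ₁(·,c) has a real zero iff c ∉ (c⁻*, c⁺*), zeros positive for c ≥ c⁺*, negative for c ≤ c⁻*). Let φ be a positive bounded C² solution of y''(t) − c y'(t) − f(y(t)) + ∫_ℝ K(s) g(y(t−s−ch)) ds = 0 with liminf_{s→−∞} φ(s) = 0. Then lim_{s→−∞} φ(s) = 0 and c ≥ c⁺*. Analogously, if liminf_{s→+∞} φ(s) = 0 then lim_{s→+∞} φ(s) = 0 and c ≤ c⁻*. Consequently, this equation has no positive bounded pulse solutions (vanishing at both ±∞) and no semi-wavefronts with speed c ∈ (c⁻*, c⁺*). -/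

import Mathlib

open MeasureTheory Filter Topology Set

/-- Convolution of `w` with the restriction of the kernel `K` to `[-N, N]`. -/
noncomputable def truncConv (K : ℝ → ℝ) (N : ℝ) (w : ℝ → ℝ) (t : ℝ) : ℝ :=
  ∫ s in Icc (-N) N, K s * w (t - s)

/-- `w` is twice differentiable at `t` and a strict subsolution there of
`w'' - c w' - F w + G (K * w) = 0`, with the kernel truncated to `[-N, N]`. -/
def StrictSubsolAt (c F G : ℝ) (K : ℝ → ℝ) (N : ℝ) (w : ℝ → ℝ) (t : ℝ) : Prop :=
  ∃ (w1 : ℝ → ℝ) (w2 : ℝ), (∀ᶠ r in 𝓝 t, HasDerivAt w (w1 r) r) ∧ HasDerivAt w1 w2 t ∧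
    0 < w2 - c * w1 t - F * w t + G * truncConv K N w t

/-- `y` is a supersolution at `t` of `y'' - c y' - F y + G (K * y) = 0`,
with the kernel truncated to `[-N, N]`. -/
def SupersolAt (c F G : ℝ) (K : ℝ → ℝ) (N : ℝ) (y : ℝ → ℝ) (t : ℝ) : Prop :=
  deriv (deriv y) t - c * deriv y t - F * y t + G * truncConv K N y t ≤ 0

lemma IsLocalMin.second_deriv_nonneg {u u1 : ℝ → ℝ} {u2 t : ℝ} (hmin : IsLocalMin u t)
    (h1 : ∀ᶠ r in 𝓝 t, HasDerivAt u (u1 r) r) (h2 : HasDerivAt u1 u2 t) :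
    u1 t = 0 ∧ 0 ≤ u2 := by
  have hd : u1 t = 0 := hmin.hasDerivAt_eq_zero h1.self_of_nhds
  refine ⟨hd, ?_⟩
  by_contra! hneg
  have he : deriv u =ᶠ[𝓝 t] u1 := h1.mono fun r hr => hr.deriv
  have hdd : deriv (deriv u) t = u2 := by rw [he.deriv_eq, h2.deriv]
  have hmax : IsLocalMax u t :=
    isLocalMax_of_deriv_deriv_neg (by rw [hdd]; exact hneg) (by rw [he.self_of_nhds, hd])
      h1.self_of_nhds.continuousAt
  have hconst : u =ᶠ[𝓝 t] fun _ => u t := by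
    filter_upwards [hmin, hmax] with r hr1 hr2
    exact le_antisymm hr2 hr1
  have : deriv (deriv u) t = 0 := by
    rw [hconst.deriv.deriv_eq]; simp
  linarith

lemma ContDiff.contDiff_deriv_two {y : ℝ → ℝ} (hy : ContDiff ℝ 2 y) : ContDiff ℝ 1 (deriv y) := by
  rw [show (2 : WithTop ℕ∞) = 1 + 1 by norm_num] at hy
  exact (contDiff_succ_iff_deriv.1 hy).2.2

lemma ContDiff.hasDerivAt_deriv_two {y : ℝ → ℝ} (hy : ContDiff ℝ 2 y) (t : ℝ) :
    HasDerivAt (deriv y) (deriv (deriv y) t) t :=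
  (hy.contDiff_deriv_two.differentiable (by norm_num) t).hasDerivAt

lemma integrableOn_mul_comp_sub {K w : ℝ → ℝ} (hK : Integrable K) (hw : Continuous w) (N t : ℝ) :
    IntegrableOn (fun s => K s * w (t - s)) (Icc (-N) N) :=
  hK.integrableOn.mul_continuousOn (by fun_prop) isCompact_Icc

/-- Sweeping principle: a strict subsolution `w` that is dominated by a positive supersolution `y`
near the boundary of a compact set is dominated by `y` on the whole set. -/
lemma le_of_strictSubsolAt {y w K : ℝ → ℝ} {c F G N : ℝ} {S : Set ℝ} (hS : IsCompact S)
    (hy : ContDiff ℝ 2 y) (hpos : ∀ t, 0 < y t) (hw : Continuous w) (hK0 : ∀ s, 0 ≤ K s)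
    (hK : Integrable K) (hG : 0 ≤ G)
    (H : ∀ t ∈ S, 0 < w t → w t ≤ y t ∨
      (SupersolAt c F G K N y t ∧ StrictSubsolAt c F G K N w t ∧
        (∀ᶠ r in 𝓝 t, r ∈ S ∨ w r ≤ 0) ∧ ∀ s ∈ Icc (-N) N, t - s ∈ S ∨ w (t - s) ≤ 0)) :
    ∀ t ∈ S, w t ≤ y t := by
  intro t ht
  have hyc : Continuous y := hy.continuous
  obtain ⟨t0, ht0, hmax⟩ := hS.exists_isMaxOn ⟨t, ht⟩
    (f := fun r => w r / y r) (hw.div hyc fun r => (hpos r).ne').continuousOn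
  set κ := w t0 / y t0 with hκ
  have hle : ∀ r ∈ S, w r ≤ κ * y r := fun r hr => by
    have := hmax hr
    simp only [mem_ofPred_eq] at this
    rwa [div_le_iff₀ (hpos r)] at this
  rcases le_or_gt κ 1 with h1 | h1
  · have := hle t ht
    nlinarith [hpos t]
  exfalso
  have hw0 : w t0 = κ * y t0 := by rw [hκ, div_mul_cancel₀ _ (hpos t0).ne']
  have hκ0 : 0 < κ := by linarith
  rcases H t0 ht0 (by rw [hw0]; exact mul_pos hκ0 (hpos t0)) with h | ⟨hsup, ⟨w1, w2, hw1, hw2, hsub⟩, hnear, hwin⟩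
  · nlinarith [hpos t0]
  have hle' : ∀ r, (r ∈ S ∨ w r ≤ 0) → 0 ≤ κ * y r - w r := by
    rintro r (hr | hr)
    · linarith [hle r hr]
    · nlinarith [hpos r]
  have hd1 : ∀ r, HasDerivAt y (deriv y r) r := fun r =>
    (hy.differentiable (by norm_num) r).hasDerivAt
  have hd2 : HasDerivAt (deriv y) (deriv (deriv y) t0) t0 := hy.hasDerivAt_deriv_two t0
  have hmin : IsLocalMin (fun r => κ * y r - w r) t0 := by
    filter_upwards [hnear] with r hr
    have := hle' r hr
    linarith
  obtain ⟨e1, e2⟩ := hmin.second_deriv_nonneg (u1 := fun r => κ * deriv y r - w1 r)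
    (u2 := κ * deriv (deriv y) t0 - w2)
    (hw1.mono fun r hr => ((hd1 r).const_mul κ).sub hr) ((hd2.const_mul κ).sub hw2)
  have hint : truncConv K N w t0 ≤ κ * truncConv K N y t0 := by
    unfold truncConv
    rw [← integral_const_mul]
    refine setIntegral_mono_on (integrableOn_mul_comp_sub hK hw N t0)
      ((integrableOn_mul_comp_sub hK hyc N t0).const_mul κ) measurableSet_Icc fun s hs => ?_
    have := mul_nonneg (hK0 s) (hle' _ (hwin s hs))
    linarith
  unfold SupersolAt at hsup
  have h3 := mul_le_mul_of_nonneg_left hint hG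
  have h4 := mul_le_mul_of_nonneg_left hsup hκ0.le
  have e1' : w1 t0 = κ * deriv y t0 := by linarith
  rw [e1', hw0] at hsub
  nlinarith

/-- Harnack-type lower bound to the right of a point. -/
lemma harnack_right {y : ℝ → ℝ} {c C : ℝ} (hy : ContDiff ℝ 2 y) (hpos : ∀ t, 0 < y t)
    (hC : 0 ≤ C) (hsup : ∀ t, deriv (deriv y) t - c * deriv y t - C * y t ≤ 0) {η N : ℝ}
    (hη : 0 < η) :
    ∃ κ > 0, ∀ t0, η ≤ y t0 → ∀ t ∈ Icc t0 (t0 + N), κ ≤ y t := by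
  set μ := |c| + C + 1 with hμ
  have hμ0 : 0 < μ := by positivity
  have hμ2 : 0 < μ ^ 2 + c * μ - C := by
    have : -|c| ≤ c := neg_abs_le c
    nlinarith [abs_nonneg c]
  refine ⟨η * (Real.exp (-(μ * N)) - Real.exp (-(μ * (N + 1)))), ?_, ?_⟩
  · apply mul_pos hη
    rw [sub_pos, Real.exp_lt_exp]
    linarith
  intro t0 ht0 t ht
  set w : ℝ → ℝ := fun r => η * (Real.exp (-(μ * (r - t0))) - Real.exp (-(μ * (N + 1)))) with hw
  have key := le_of_strictSubsolAt (w := w) (K := fun _ => 0) (c := c) (F := C) (G := 0) (N := 0)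
    (isCompact_Icc (a := t0) (b := t0 + (N + 1))) hy hpos (by fun_prop) (fun _ => le_rfl)
    (integrable_zero _ _ _) le_rfl ?_ t ⟨ht.1, by linarith [ht.2]⟩
  · refine le_trans ?_ key
    rw [hw]
    apply mul_le_mul_of_nonneg_left _ hη.le
    apply sub_le_sub_right
    rw [Real.exp_le_exp]
    nlinarith [ht.2]
  intro r hr hwr
  have hr2 : r < t0 + (N + 1) := by
    rw [hw] at hwr
    have := (mul_pos_iff_of_pos_left hη).1 hwr
    rw [sub_pos, Real.exp_lt_exp] at this
    nlinarith
  rcases hr.1.eq_or_lt with h | h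
  · left
    rw [hw, ← h]
    simp only [sub_self, mul_zero, neg_zero, Real.exp_zero]
    nlinarith [Real.exp_pos (-(μ * (N + 1)))]
  right
  have hS : ∀ᶠ x in 𝓝 r, x ∈ Icc t0 (t0 + (N + 1)) := Icc_mem_nhds h hr2
  refine ⟨?_, ⟨fun x => η * (-μ * Real.exp (-(μ * (x - t0)))),
    η * (μ ^ 2 * Real.exp (-(μ * (r - t0)))), ?_, ?_, ?_⟩, hS.mono fun x hx => Or.inl hx, ?_⟩
  · have := hsup r
    unfold SupersolAt
    linarith
  · refine Eventually.of_forall fun x => ?_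
    have h1 : HasDerivAt (fun x => -(μ * (x - t0))) (-μ) x := by
      simpa using (((hasDerivAt_id' x).sub_const t0).const_mul μ).fun_neg
    refine ((h1.exp.sub_const _).const_mul η).congr_deriv ?_
    ring
  · have h1 : HasDerivAt (fun x => -(μ * (x - t0))) (-μ) r := by
      simpa using (((hasDerivAt_id' r).sub_const t0).const_mul μ).fun_neg
    refine ((h1.exp.const_mul (-μ)).const_mul η).congr_deriv ?_
    ring
  · rw [hw]
    have h1 := mul_pos (mul_pos hη hμ2) (Real.exp_pos (-(μ * (r - t0))))
    have h2 := mul_nonneg (mul_nonneg hη.le hC) (Real.exp_pos (-(μ * (N + 1)))).le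
    simp only [zero_mul, add_zero]
    nlinarith
  · intro s hs
    have : s = 0 := by simpa using hs
    left; simpa [this] using hr

lemma deriv_comp_neg_fun (y : ℝ → ℝ) : deriv (fun t => y (-t)) = fun t => -deriv y (-t) :=
  funext fun t => deriv_comp_neg y t

lemma deriv_deriv_comp_neg (y : ℝ → ℝ) (t : ℝ) :
    deriv (deriv fun t => y (-t)) t = deriv (deriv y) (-t) := by
  rw [deriv_comp_neg_fun, deriv.fun_neg, deriv_comp_neg, neg_neg]

/-- Harnack-type lower bound around a point. -/
lemma harnack {y : ℝ → ℝ} {c C : ℝ} (hy : ContDiff ℝ 2 y) (hpos : ∀ t, 0 < y t)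
    (hC : 0 ≤ C) (hsup : ∀ t, deriv (deriv y) t - c * deriv y t - C * y t ≤ 0) {η N : ℝ}
    (hη : 0 < η) :
    ∃ κ > 0, ∀ t0, η ≤ y t0 → ∀ t ∈ Icc (t0 - N) (t0 + N), κ ≤ y t := by
  obtain ⟨κ1, h1, H1⟩ := harnack_right hy hpos hC hsup hη
  obtain ⟨κ2, h2, H2⟩ := harnack_right (y := fun t => y (-t)) (c := -c) (hy.comp contDiff_neg)
    (fun t => hpos _) hC (fun t => by
      rw [deriv_deriv_comp_neg, deriv_comp_neg]
      have := hsup (-t)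
      linarith) (N := N) hη
  refine ⟨min κ1 κ2, lt_min h1 h2, fun t0 ht0 t ht => ?_⟩
  rcases le_total t0 t with h | h
  · exact (min_le_left _ _).trans (H1 t0 ht0 t ⟨h, ht.2⟩)
  · have := H2 (-t0) (by simpa using ht0) (-t) ⟨by linarith, by linarith [ht.1]⟩
    rw [neg_neg] at this
    exact (min_le_right _ _).trans this

/-- Without the nonlocal term there is no positive bounded entire solution. -/
lemma not_bounded_of_local_eq {y f : ℝ → ℝ} {c M : ℝ} (hy : ContDiff ℝ 2 y)
    (hpos : ∀ t, 0 < y t) (hM : ∀ t, y t ≤ M) (hf : StrictMonoOn f (Ici 0)) (hf0 : f 0 = 0)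
    (heq : ∀ t, deriv (deriv y) t - c * deriv y t = f (y t)) : False := by
  have hm : 0 < f (y 0) := by
    have := hf (mem_Ici.2 le_rfl) (hpos 0).le (hpos 0)
    rwa [hf0] at this
  obtain ⟨B, hB1, hBM⟩ : ∃ B : ℝ, 1 ≤ B ∧ M ≤ B := ⟨max 1 M, le_max_left _ _, le_max_right _ _⟩
  obtain ⟨ρ, hρ0, hρ1, hρm⟩ : ∃ ρ : ℝ, 0 < ρ ∧ ρ ≤ 1 ∧ ρ * (2 + 2 * |c| * B) < f (y 0) := by
    have hden : 0 < 2 * (2 + 2 * |c| * B) := by positivity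
    refine ⟨min 1 (f (y 0) / (2 * (2 + 2 * |c| * B))), lt_min one_pos (div_pos hm hden),
      min_le_left _ _, ?_⟩
    have h1 : min 1 (f (y 0) / (2 * (2 + 2 * |c| * B))) ≤ f (y 0) / (2 * (2 + 2 * |c| * B)) :=
      min_le_right _ _
    rw [le_div_iff₀ hden] at h1
    linarith
  have hcont : Continuous fun t => ρ ^ 2 * t ^ 2 - y t := by
    have := hy.continuous
    fun_prop
  have hlim : Tendsto (fun t : ℝ => ρ ^ 2 * t ^ 2 - y t) (cocompact ℝ) atTop := by
    have h1 : Tendsto (fun t : ℝ => t ^ 2) (cocompact ℝ) atTop := by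
      simpa [Function.comp_def] using
        (tendsto_pow_atTop two_ne_zero).comp (tendsto_norm_cocompact_atTop (E := ℝ))
    refine tendsto_atTop_mono (fun t => ?_)
      (tendsto_atTop_add_const_right _ (-M) (h1.const_mul_atTop (by positivity : 0 < ρ ^ 2)))
    have := hM t
    linarith
  obtain ⟨t0, ht0⟩ := hcont.exists_forall_le hlim
  have hd1 : ∀ r, HasDerivAt y (deriv y r) r := fun r =>
    (hy.differentiable (by norm_num) r).hasDerivAt
  have hd2 : HasDerivAt (deriv y) (deriv (deriv y) t0) t0 := hy.hasDerivAt_deriv_two t0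
  have hmin : IsLocalMin (fun t => ρ ^ 2 * t ^ 2 - y t) t0 := Eventually.of_forall ht0
  obtain ⟨e1, e2⟩ := hmin.second_deriv_nonneg (u1 := fun r => ρ ^ 2 * (2 * r) - deriv y r)
    (u2 := ρ ^ 2 * 2 - deriv (deriv y) t0)
    (Eventually.of_forall fun r => by
      refine HasDerivAt.sub ?_ (hd1 r)
      simpa using (hasDerivAt_pow 2 r).const_mul (ρ ^ 2))
    (by
      refine HasDerivAt.sub ?_ hd2
      simpa using ((hasDerivAt_id t0).const_mul 2).const_mul (ρ ^ 2))
  have h0 := ht0 0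
  simp only [ne_eq, OfNat.ofNat_ne_zero, not_false_eq_true, zero_pow, mul_zero, zero_sub] at h0
  have hge : y 0 ≤ y t0 := by nlinarith [sq_nonneg (ρ * t0)]
  have hfge : f (y 0) ≤ f (y t0) := hf.monotoneOn (hpos 0).le (hpos t0).le hge
  have hsq : |ρ * t0| ≤ B := by
    apply abs_le_of_sq_le_sq _ (by linarith)
    nlinarith [hM t0, hpos 0]
  have hct : -(c * (ρ * t0)) ≤ |c| * B := by
    calc -(c * (ρ * t0)) ≤ |c * (ρ * t0)| := neg_le_abs _
      _ = |c| * |ρ * t0| := abs_mul _ _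
      _ ≤ |c| * B := by gcongr
  have := heq t0
  have e1' : deriv y t0 = ρ ^ 2 * (2 * t0) := by linarith
  rw [e1'] at this
  nlinarith

/-- The exponential times a wide parabolic bump, cut off at zero and squared. -/
noncomputable def bump (z R tc r : ℝ) : ℝ := Real.exp (z * r) * (max 0 (1 - ((r - tc) / R) ^ 2)) ^ 2

lemma continuous_bump (z R tc : ℝ) : Continuous (bump z R tc) := by
  unfold bump; fun_prop

lemma bump_zero_le_one (R tc r : ℝ) : bump 0 R tc r ≤ 1 := by
  unfold bump
  rw [zero_mul, Real.exp_zero, one_mul]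
  apply pow_le_one₀ (le_max_left _ _)
  exact max_le zero_le_one (by nlinarith [sq_nonneg ((r - tc) / R)])

lemma integrableOn_mul_exp {K p : ℝ → ℝ} (hK : Integrable K) (hp : Continuous p) (z N : ℝ) :
    IntegrableOn (fun s => p s * (K s * Real.exp (-(z * s)))) (Icc (-N) N) := by
  have : IntegrableOn (fun s => K s * (p s * Real.exp (-(z * s)))) (Icc (-N) N) :=
    hK.integrableOn.mul_continuousOn (by fun_prop) isCompact_Icc
  exact this.congr_fun (fun s _ => by ring) measurableSet_Icc

/-- If the truncated characteristic function `χ` is positive at `z`, then sufficiently wide bumps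
are strict subsolutions on the half of their support where the `χ'(z)` term has a good sign. -/
lemma strictSubsolAt_bump {c F G N z : ℝ} {K : ℝ → ℝ} (hK0 : ∀ s, 0 ≤ K s) (hK : Integrable K)
    (hG : 0 ≤ G)
    (hχ : 0 < z ^ 2 - c * z - F + G * ∫ s in Icc (-N) N, K s * Real.exp (-(z * s))) :
    ∃ R0 > 0, ∀ R ≥ R0, ∀ tc t k, 0 < k → 0 < 1 - ((t - tc) / R) ^ 2 →
      (2 * z - c - G * ∫ s in Icc (-N) N, s * (K s * Real.exp (-(z * s)))) * (t - tc) ≤ 0 →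
      StrictSubsolAt c F G K N (fun r => k * bump z R tc r) t := by
  set E0 := ∫ s in Icc (-N) N, K s * Real.exp (-(z * s)) with hE0
  set E1 := ∫ s in Icc (-N) N, s * (K s * Real.exp (-(z * s))) with hE1
  set E2 := ∫ s in Icc (-N) N, s ^ 2 * (K s * Real.exp (-(z * s))) with hE2
  set χ := z ^ 2 - c * z - F + G * E0 with hχdef
  set d := 2 * z - c - G * E1 with hd
  have hE2nn : 0 ≤ E2 := integral_nonneg fun s => by
    have := hK0 s
    positivity
  set C := 4 + 2 * G * E2 with hC
  have hC0 : 0 < C := by positivity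
  refine ⟨1 + (8 + C) ^ 2 / (32 * χ), by positivity, fun R hR tc t k hk ha hdx => ?_⟩
  have hR1 : 1 ≤ R := le_trans (by simp; positivity) hR
  have hR0 : 0 < R := by linarith
  have hRC : (8 + C) ^ 2 < R ^ 2 * (32 * χ) := by
    have h1 : (8 + C) ^ 2 / (32 * χ) < R := by linarith
    rw [div_lt_iff₀ (by positivity)] at h1
    nlinarith
  obtain ⟨ι, hι⟩ : ∃ ι, ι = R⁻¹ := ⟨_, rfl⟩
  have hιR : ι * R = 1 := by rw [hι, inv_mul_cancel₀ hR0.ne']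
  have hι0 : 0 < ι := by rw [hι]; positivity
  have hbump : ∀ r, bump z R tc r = Real.exp (z * r) * (max 0 (1 - ((r - tc) * ι) ^ 2)) ^ 2 :=
    fun r => by rw [bump, hι, div_eq_mul_inv]
  rw [div_eq_mul_inv, ← hι] at ha
  set x := t - tc with hx
  set a := 1 - (x * ι) ^ 2 with hadef
  have hloc : ∀ᶠ r in 𝓝 t, 0 < 1 - ((r - tc) * ι) ^ 2 := by
    have : Continuous fun r => 1 - ((r - tc) * ι) ^ 2 := by fun_prop
    exact this.continuousAt.eventually (lt_mem_nhds ha)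
  have hq : ∀ r, HasDerivAt (fun r => 1 - ((r - tc) * ι) ^ 2) (-(2 * ι ^ 2 * (r - tc))) r := fun r => by
    have h1 := (((hasDerivAt_id' r).sub_const tc).mul_const ι).fun_pow 2
    refine (h1.const_sub 1).congr_deriv ?_
    push_cast; ring
  have hq' : HasDerivAt (fun r => -(2 * ι ^ 2 * (r - tc))) (-(2 * ι ^ 2)) t := by
    refine (((hasDerivAt_id' t).sub_const tc).const_mul (2 * ι ^ 2)).fun_neg.congr_deriv ?_
    ring
  have he : ∀ r, HasDerivAt (fun r => Real.exp (z * r)) (z * Real.exp (z * r)) r := fun r => by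
    refine ((hasDerivAt_id' r).const_mul z).exp.congr_deriv ?_
    ring
  set e := Real.exp (z * t) with hedef
  have he0 : 0 < e := Real.exp_pos _
  set a1 := -(2 * ι ^ 2 * x) with ha1
  refine ⟨fun r => k * (z * Real.exp (z * r) * (1 - ((r - tc) * ι) ^ 2) ^ 2 + Real.exp (z * r) *
      (2 * (1 - ((r - tc) * ι) ^ 2) * (-(2 * ι ^ 2 * (r - tc))))),
    k * (e * (z ^ 2 * a ^ 2 + 4 * z * a * a1 + 2 * a1 ^ 2 + 2 * a * (-(2 * ι ^ 2)))), ?_, ?_, ?_⟩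
  · filter_upwards [hloc.eventually_nhds] with r hr
    have h1 := (((he r).fun_mul ((hq r).fun_pow 2)).const_mul k)
    have h2 : (fun r => k * bump z R tc r) =ᶠ[𝓝 r]
        fun r => k * (Real.exp (z * r) * (1 - ((r - tc) * ι) ^ 2) ^ 2) := by
      filter_upwards [hr] with r' hr'
      rw [hbump, max_eq_right hr'.le]
    refine (HasDerivAt.congr_of_eventuallyEq ?_ h2)
    refine h1.congr_deriv ?_
    push_cast; ring
  · refine (((((he t).const_mul z).fun_mul ((hq t).fun_pow 2)).fun_add
      ((he t).fun_mul (((hq t).const_mul 2).fun_mul hq'))).const_mul k).congr_deriv ?_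
    simp only [← hx, ← hadef, ← hedef, ← ha1]
    push_cast; ring
  · have hint : k * (e * (a ^ 2 * E0 - 2 * a * a1 * E1 - 2 * a * ι ^ 2 * E2)) ≤
        truncConv K N (fun r => k * bump z R tc r) t := by
      have i0 : IntegrableOn (fun s => K s * Real.exp (-(z * s))) (Icc (-N) N) := by
        simpa using integrableOn_mul_exp hK (p := fun _ => 1) (by fun_prop) z N
      have i1 := integrableOn_mul_exp hK (p := fun s => s) (by fun_prop) z N
      have i2 := integrableOn_mul_exp hK (p := fun s => s ^ 2) (by fun_prop) z N
      have j0 := i0.const_mul (a ^ 2)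
      have j1 := i1.const_mul (2 * a * a1)
      have j2 := i2.const_mul (2 * a * ι ^ 2)
      have j01 : IntegrableOn (fun s => a ^ 2 * (K s * Real.exp (-(z * s))) -
            2 * a * a1 * (s * (K s * Real.exp (-(z * s))))) (Icc (-N) N) := j0.sub j1
      have hsum : k * (e * (a ^ 2 * E0 - 2 * a * a1 * E1 - 2 * a * ι ^ 2 * E2)) =
          ∫ s in Icc (-N) N, k * (e * (a ^ 2 * (K s * Real.exp (-(z * s))) -
            2 * a * a1 * (s * (K s * Real.exp (-(z * s)))) -
            2 * a * ι ^ 2 * (s ^ 2 * (K s * Real.exp (-(z * s)))))) := by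
        rw [integral_const_mul, integral_const_mul, integral_sub j01 j2, integral_sub j0 j1,
          integral_const_mul, integral_const_mul, integral_const_mul]
      rw [hsum]
      refine setIntegral_mono_on
        (((j01.sub j2).const_mul e).const_mul k)
        (integrableOn_mul_comp_sub hK ((continuous_bump z R tc).const_mul k) N t)
        measurableSet_Icc fun s _ => ?_
      beta_reduce
      rw [hbump, show z * (t - s) = z * t + -(z * s) by ring, Real.exp_add, ← hedef]
      have hKe : 0 ≤ k * e * (K s * Real.exp (-(z * s))) := by
        have := hK0 s
        positivity
      have hy : a ^ 2 - 2 * a * a1 * s - 2 * a * ι ^ 2 * s ^ 2 ≤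
          (max 0 (1 - ((t - s - tc) * ι) ^ 2)) ^ 2 := by
        set y := max 0 (1 - ((t - s - tc) * ι) ^ 2) with hydef
        have h1 : 1 - ((t - s - tc) * ι) ^ 2 ≤ y := le_max_right _ _
        have h2 : 1 - ((t - s - tc) * ι) ^ 2 = a - a1 * s - ι ^ 2 * s ^ 2 := by
          rw [hadef, ha1, hx]; ring
        rw [h2] at h1
        nlinarith only [h1, ha, sq_nonneg (y - a)]
      have := mul_le_mul_of_nonneg_left hy hKe
      linarith only [this]
    have hGint := mul_le_mul_of_nonneg_left hint hG
    have hval : k * bump z R tc t = k * (e * a ^ 2) := by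
      rw [hbump, ← hx, ← hadef, max_eq_right ha.le]
    simp only [← hx, ← hadef, ← hedef, ← ha1]
    rw [hval]
    have hx2 : x ^ 2 * ι ^ 2 = 1 - a := by rw [hadef]; ring
    have ha12 : 2 * a1 ^ 2 = 8 * ι ^ 2 * (1 - a) := by rw [← hx2, ha1]; ring
    have hquad : 0 < R ^ 2 * χ * a ^ 2 + 8 - (8 + C) * a := by
      have h1 : (8 + C) ^ 2 * a ^ 2 < R ^ 2 * (32 * χ) * a ^ 2 :=
        mul_lt_mul_of_pos_right hRC (by positivity)
      nlinarith only [h1, sq_nonneg ((8 + C) * a - 16)]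
    have hpos : 0 < χ * a ^ 2 + 2 * a * a1 * d + 8 * ι ^ 2 * (1 - a) - C * a * ι ^ 2 := by
      have h1 : 0 ≤ 2 * a * a1 * d := by
        have : 2 * a * a1 * d = 4 * a * ι ^ 2 * (-(d * x)) := by rw [ha1]; ring
        rw [this]
        exact mul_nonneg (by positivity) (neg_nonneg.2 hdx)
      have h2 : 0 < ι ^ 2 * (R ^ 2 * χ * a ^ 2 + 8 - (8 + C) * a) := mul_pos (by positivity) hquad
      have h3 : ι ^ 2 * (R ^ 2 * χ * a ^ 2) = χ * a ^ 2 := by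
        calc _ = (ι * R) ^ 2 * (χ * a ^ 2) := by ring
          _ = _ := by rw [hιR]; ring
      have h4 : ι ^ 2 * (R ^ 2 * χ * a ^ 2 + 8 - (8 + C) * a) =
          ι ^ 2 * (R ^ 2 * χ * a ^ 2) + 8 * ι ^ 2 * (1 - a) - C * a * ι ^ 2 := by ring
      rw [h4, h3] at h2
      linarith only [h1, h2]
    have hfin := mul_pos (mul_pos hk he0) hpos
    have hexp : k * e * (χ * a ^ 2 + 2 * a * a1 * d + 8 * ι ^ 2 * (1 - a) - C * a * ι ^ 2) =
        k * (e * (z ^ 2 * a ^ 2 + 4 * z * a * a1 + 2 * a1 ^ 2 + 2 * a * (-(2 * ι ^ 2)))) -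
        c * (k * (z * e * a ^ 2 + e * (2 * a * a1))) - F * (k * (e * a ^ 2)) +
        G * (k * (e * (a ^ 2 * E0 - 2 * a * a1 * E1 - 2 * a * ι ^ 2 * E2))) := by
      rw [ha12, hχdef, hd, hC]; ring
    linarith only [hfin, hexp, hGint]

lemma bump_eq_zero {z R tc r : ℝ} (hR : 0 < R) (hr : r ∉ Icc (tc - R) (tc + R)) :
    bump z R tc r = 0 := by
  have h1 : R ≤ |r - tc| := by
    by_contra! h
    rw [abs_lt] at h
    exact hr ⟨by linarith, by linarith⟩
  have h2 : 1 ≤ ((r - tc) / R) ^ 2 := by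
    rw [← sq_abs, abs_div, abs_of_pos hR]
    exact one_le_pow₀ ((one_le_div hR).2 h1)
  rw [bump, max_eq_left (by linarith)]
  simp

lemma one_sub_sq_pos_of_bump_pos {z R tc r : ℝ} (h : 0 < bump z R tc r) :
    0 < 1 - ((r - tc) / R) ^ 2 := by
  by_contra! h'
  rw [bump, max_eq_left h'] at h
  simp at h

lemma mem_Ioo_of_bump_pos {z R tc r : ℝ} (hR : 0 < R) (h : 0 < bump z R tc r) :
    r ∈ Ioo (tc - R) (tc + R) := by
  have h1 := one_sub_sq_pos_of_bump_pos h
  have h2 : ((r - tc) / R) ^ 2 < 1 := by linarith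
  rw [sq_lt_one_iff_abs_lt_one, abs_div, abs_of_pos hR, div_lt_one hR, abs_lt] at h2
  exact ⟨by linarith, by linarith⟩

lemma tendsto_bump_one (tc t : ℝ) : Tendsto (fun R => bump 0 R tc t) atTop (𝓝 1) := by
  have h1 : Tendsto (fun R : ℝ => (t - tc) / R) atTop (𝓝 0) :=
    tendsto_const_nhds.div_atTop tendsto_id
  have h2 : Continuous fun x : ℝ => Real.exp (0 * t) * (max 0 (1 - x ^ 2)) ^ 2 := by fun_prop
  simpa [bump, Function.comp_def] using (h2.tendsto 0).comp h1

section Barrier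

variable {y K : ℝ → ℝ} {c C F G N η : ℝ}

/-- On an interval where `y` is smaller than `η` inside but at least `η` at the endpoints, `y` is
bounded below by a constant that does not depend on the interval. -/
lemma exists_lower_bound_between (hy : ContDiff ℝ 2 y) (hpos : ∀ t, 0 < y t)
    (hC : 0 ≤ C) (hloc : ∀ t, deriv (deriv y) t - c * deriv y t - C * y t ≤ 0)
    (hK0 : ∀ s, 0 ≤ K s) (hK : Integrable K) (hG : 0 ≤ G) (hN : 0 ≤ N) (hη : 0 < η)
    (hsup : ∀ t, (∀ s ∈ Icc (-N) N, y (t - s) < η) → SupersolAt c F G K N y t)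
    (hχ : 0 < (0 : ℝ) ^ 2 - c * 0 - F + G * ∫ s in Icc (-N) N, K s * Real.exp (-(0 * s))) :
    ∃ k > 0, ∀ α β, η ≤ y α → η ≤ y β → (∀ t ∈ Ioo α β, y t < η) →
      ∀ t ∈ Icc α β, k ≤ y t := by
  obtain ⟨κ, hκ, hHar⟩ := harnack (N := N) hy hpos hC hloc hη
  obtain ⟨R0, hR0, hsub⟩ := strictSubsolAt_bump hK0 hK hG hχ
  refine ⟨κ, hκ, fun α β hα hβ hin t ht => ?_⟩
  set d := 2 * 0 - c - G * ∫ s in Icc (-N) N, s * (K s * Real.exp (-(0 * s))) with hd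
  obtain ⟨tc, htc⟩ : ∃ tc, ∀ r ∈ Icc α β, d * (r - tc) ≤ 0 := by
    rcases le_total 0 d with h | h
    · exact ⟨β, fun r hr => mul_nonpos_of_nonneg_of_nonpos h (by linarith [hr.2])⟩
    · exact ⟨α, fun r hr => mul_nonpos_of_nonpos_of_nonneg h (by linarith [hr.1])⟩
  have key : ∀ R ≥ R0, κ * bump 0 R tc t ≤ y t := fun R hR => by
    refine le_of_strictSubsolAt (w := fun r => κ * bump 0 R tc r) (c := c) (F := F) (N := N)
      isCompact_Icc hy hpos ((continuous_bump 0 R tc).const_mul κ) hK0 hK hG (fun r hr hwr => ?_) t ht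
    have hle : κ * bump 0 R tc r ≤ κ := mul_le_of_le_one_right hκ.le (bump_zero_le_one R tc r)
    rcases le_or_gt r (α + N) with h1 | h1
    · exact Or.inl (hle.trans (hHar α hα r ⟨by linarith [hr.1], h1⟩))
    rcases le_or_gt (β - N) r with h2 | h2
    · exact Or.inl (hle.trans (hHar β hβ r ⟨h2, by linarith [hr.2]⟩))
    right
    have hwin : ∀ s ∈ Icc (-N) N, r - s ∈ Ioo α β := fun s hs =>
      ⟨by linarith [hs.2], by linarith [hs.1]⟩
    refine ⟨hsup r fun s hs => hin _ (hwin s hs), hsub R hR tc r κ hκ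
      (one_sub_sq_pos_of_bump_pos (pos_of_mul_pos_right hwr hκ.le)) (htc r hr), ?_,
      fun s hs => Or.inl (Ioo_subset_Icc_self (hwin s hs))⟩
    filter_upwards [Icc_mem_nhds (show α < r by linarith) (show r < β by linarith)] with x hx
    exact Or.inl hx
  refine le_of_tendsto (f := fun R => κ * bump 0 R tc t) (x := atTop) ?_
    ((eventually_ge_atTop R0).mono key)
  simpa using (tendsto_bump_one tc t).const_mul κ

lemma tendsto_zero_of_liminf (hy : ContDiff ℝ 2 y) (hpos : ∀ t, 0 < y t)
    (hC : 0 ≤ C) (hloc : ∀ t, deriv (deriv y) t - c * deriv y t - C * y t ≤ 0)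
    (hK0 : ∀ s, 0 ≤ K s) (hK : Integrable K) (hG : 0 ≤ G) (hN : 0 ≤ N) (hη : 0 < η)
    (hsup : ∀ t, (∀ s ∈ Icc (-N) N, y (t - s) < η) → SupersolAt c F G K N y t)
    (hχ : 0 < (0 : ℝ) ^ 2 - c * 0 - F + G * ∫ s in Icc (-N) N, K s * Real.exp (-(0 * s)))
    (hbd : ∃ M, ∀ t, y t ≤ M) (hlim : liminf y atBot = 0) : Tendsto y atBot (𝓝 0) := by
  by_contra hnot
  obtain ⟨ε, hε, hfreq⟩ : ∃ ε > 0, ∃ᶠ t in atBot, ε ≤ y t := by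
    by_contra! h
    apply hnot
    rw [Metric.tendsto_nhds]
    intro ε hε
    filter_upwards [h ε hε] with t ht
    rw [Real.dist_eq, sub_zero, abs_of_pos (hpos t)]
    exact ht
  obtain ⟨M, hM⟩ := hbd
  obtain ⟨k, hk, hbetween⟩ := exists_lower_bound_between (η := min ε η) hy hpos hC hloc hK0 hK hG hN
    (lt_min hε hη) (fun t ht => hsup t fun s hs => (ht s hs).trans_le (min_le_right _ _)) hχ
  set η' := min ε η with hη'
  have hη'0 : 0 < η' := lt_min hε hη
  have hsmall : ∃ᶠ t in atBot, y t < min k η' := by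
    refine frequently_lt_of_liminf_lt ?_ (by rw [hlim]; exact lt_min hk hη'0)
    exact (isBoundedUnder_of ⟨M, hM⟩ : IsBoundedUnder (· ≤ ·) atBot y).isCoboundedUnder_ge
  rw [frequently_atBot] at hfreq hsmall
  obtain ⟨t1, -, h1⟩ := hfreq 0
  obtain ⟨t2, h21, h2⟩ := hsmall t1
  obtain ⟨t3, h32, h3⟩ := hfreq t2
  have hcl : IsClosed {t | η' ≤ y t} := isClosed_le continuous_const hy.continuous
  have hmin : η' ≤ ε := min_le_left _ _
  obtain ⟨α, ⟨hα, hαη⟩, hαmax⟩ := ((isCompact_Icc (a := t3) (b := t2)).inter_right hcl).exists_isGreatest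
    ⟨t3, ⟨le_rfl, h32⟩, hmin.trans h3⟩
  obtain ⟨β, ⟨hβ, hβη⟩, hβmin⟩ := ((isCompact_Icc (a := t2) (b := t1)).inter_right hcl).exists_isLeast
    ⟨t1, ⟨h21, le_rfl⟩, hmin.trans h1⟩
  have := hbetween α β hαη hβη (fun t ht => ?_) t2 ⟨hα.2, hβ.1⟩
  · exact absurd (this.trans_lt h2) (not_lt.2 (min_le_left _ _))
  by_contra! hge
  rcases le_total t t2 with h | h
  · exact absurd (hαmax ⟨⟨hα.1.trans ht.1.le, h⟩, hge⟩) (not_le.2 ht.1)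
  · exact absurd (hβmin ⟨⟨h, ht.2.le.trans hβ.2⟩, hge⟩) (not_le.2 ht.2)

lemma continuous_integral_mul_exp {p : ℝ → ℝ} (hK : Integrable K) (hp : Continuous p) (N : ℝ) :
    Continuous fun z : ℝ => ∫ s in Icc (-N) N, p s * (K s * Real.exp (-(z * s))) := by
  rw [continuous_iff_continuousAt]
  intro z0
  have hb : IntegrableOn (fun s => |K s| * (|p s| * Real.exp ((|z0| + 1) * |s|))) (Icc (-N) N) :=
    hK.abs.integrableOn.mul_continuousOn (by fun_prop) isCompact_Icc
  refine continuousAt_of_dominated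
    (Eventually.of_forall fun z => (integrableOn_mul_exp hK hp z N).aestronglyMeasurable)
    ?_ hb (ae_of_all _ fun s => by fun_prop)
  filter_upwards [Metric.ball_mem_nhds z0 one_pos] with z hz
  refine ae_of_all _ fun s => ?_
  have hz' : |z| ≤ |z0| + 1 := by
    rw [Metric.mem_ball, Real.dist_eq] at hz
    linarith [abs_sub_abs_le_abs_sub z z0]
  rw [norm_mul, norm_mul, Real.norm_eq_abs, Real.norm_eq_abs, Real.norm_eq_abs, Real.abs_exp,
    mul_left_comm]
  gcongr
  calc -(z * s) ≤ |z * s| := neg_le_abs _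
    _ = |z| * |s| := abs_mul _ _
    _ ≤ _ := by gcongr

/-- A positive function tending to zero at `-∞` that is a supersolution wherever it is small forces
the truncated characteristic function to be nonpositive somewhere on `[0, ∞)`. -/
lemma exists_char_nonpos_of_tendsto_zero (hy : ContDiff ℝ 2 y) (hpos : ∀ t, 0 < y t)
    (hC : 0 ≤ C) (hloc : ∀ t, deriv (deriv y) t - c * deriv y t - C * y t ≤ 0)
    (hK0 : ∀ s, 0 ≤ K s) (hK : Integrable K) (hG : 0 ≤ G) (hN : 0 ≤ N) (hη : 0 < η)
    (hsup : ∀ t, (∀ s ∈ Icc (-N) N, y (t - s) < η) → SupersolAt c F G K N y t)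
    (hlim : Tendsto y atBot (𝓝 0)) :
    ∃ z ≥ 0, z ^ 2 - c * z - F + G * ∫ s in Icc (-N) N, K s * Real.exp (-(z * s)) ≤ 0 := by
  by_contra! hχ
  obtain ⟨T, hT⟩ := eventually_atBot.1 (hlim.eventually (gt_mem_nhds hη))
  set d : ℝ → ℝ := fun z => 2 * z - c - G * ∫ s in Icc (-N) N, s * (K s * Real.exp (-(z * s)))
    with hd
  have hdc : Continuous d := by
    have := continuous_integral_mul_exp (p := fun s => s) hK continuous_id N
    fun_prop
  rcases le_or_gt 0 (d 0) with hd0 | hd0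
  · obtain ⟨κ, hκ, hHar⟩ := harnack (N := N) hy hpos hC hloc (hpos T)
    obtain ⟨R0, hR0, hsub⟩ := strictSubsolAt_bump hK0 hK hG (hχ 0 le_rfl)
    have key : ∀ t ≤ T, ∀ R, R0 ≤ R → T - t ≤ R → κ * bump 0 R T t ≤ y t := fun t ht R hR htR => by
      have hRpos : 0 < R := by linarith
      have hout : ∀ x < T, x ∈ Icc (T - R) T ∨ κ * bump 0 R T x ≤ 0 := fun x hx => by
        by_cases h : T - R ≤ x
        · exact Or.inl ⟨h, hx.le⟩
        · rw [bump_eq_zero hRpos fun h' => h h'.1]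
          simp
      refine le_of_strictSubsolAt (S := Icc (T - R) T) (w := fun r => κ * bump 0 R T r) (c := c)
        (F := F) (N := N) isCompact_Icc hy hpos ((continuous_bump 0 R T).const_mul κ) hK0 hK hG
        (fun r hr hwr => ?_) t ⟨by linarith, ht⟩
      have hle : κ * bump 0 R T r ≤ κ := mul_le_of_le_one_right hκ.le (bump_zero_le_one R T r)
      rcases le_or_gt (T - N) r with h1 | h1
      · exact Or.inl (hle.trans (hHar T le_rfl r ⟨h1, by linarith [hr.2]⟩))
      right
      refine ⟨hsup r fun s hs => hT _ (by linarith [hs.1]), hsub R hR T r κ hκ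
        (one_sub_sq_pos_of_bump_pos (pos_of_mul_pos_right hwr hκ.le))
        (mul_nonpos_of_nonneg_of_nonpos hd0 (by linarith [hr.2])), ?_,
        fun s hs => hout _ (by linarith [hs.1])⟩
      filter_upwards [gt_mem_nhds (show r < T by linarith)] with x hx
      exact hout x hx
    have hge : ∀ t ≤ T, κ ≤ y t := fun t ht => by
      refine le_of_tendsto (f := fun R => κ * bump 0 R T t) (x := atTop) ?_ ?_
      · simpa using (tendsto_bump_one T t).const_mul κ
      · filter_upwards [eventually_ge_atTop R0, eventually_ge_atTop (T - t)] with R h1 h2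
        exact key t ht R h1 h2
    have := ge_of_tendsto hlim (eventually_atBot.2 ⟨T, hge⟩)
    linarith
  · set κ0 := ∫ s in Icc (-N) N, K s with hκ0
    have hκ0nn : 0 ≤ κ0 := integral_nonneg fun s => hK0 s
    have hbound : ∀ z ≥ 0, ∫ s in Icc (-N) N, s * (K s * Real.exp (-(z * s))) ≤ N * κ0 := by
      intro z hz
      rw [hκ0, ← integral_const_mul]
      refine setIntegral_mono_on (integrableOn_mul_exp hK continuous_id z N)
        (hK.integrableOn.const_mul N) measurableSet_Icc fun s hs => ?_
      rcases le_total s 0 with h | h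
      · exact (mul_nonpos_of_nonpos_of_nonneg h (mul_nonneg (hK0 s) (Real.exp_pos _).le)).trans
          (mul_nonneg hN (hK0 s))
      · have : Real.exp (-(z * s)) ≤ 1 := Real.exp_le_one_iff.2 (by nlinarith)
        exact mul_le_mul hs.2 (mul_le_of_le_one_right (hK0 s) this)
          (mul_nonneg (hK0 s) (Real.exp_pos _).le) hN
    set Z := |c| + G * (N * κ0) with hZ
    have hZ0 : 0 ≤ Z := by positivity
    have hdZ : 0 ≤ d Z := by
      have h1 := mul_le_mul_of_nonneg_left (hbound Z hZ0) hG
      have h2 := le_abs_self c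
      have h3 := abs_nonneg c
      have h4 : 0 ≤ G * (N * κ0) := by positivity
      simp only [hd]
      linarith
    obtain ⟨z, hz, hdz⟩ := intermediate_value_Icc hZ0 hdc.continuousOn ⟨hd0.le, hdZ⟩
    obtain ⟨R, hR, hsub⟩ := strictSubsolAt_bump hK0 hK hG (hχ z hz.1)
    set tc := T - N - R with htc
    have key : ∀ k > 0, k * bump z R tc tc ≤ y tc := fun k hk => by
      have hout : ∀ x, x ∈ Icc (tc - R) (tc + R) ∨ k * bump z R tc x ≤ 0 := fun x => by
        by_cases h : x ∈ Icc (tc - R) (tc + R)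
        · exact Or.inl h
        · rw [bump_eq_zero hR h]
          simp
      refine le_of_strictSubsolAt (S := Icc (tc - R) (tc + R)) (w := fun r => k * bump z R tc r)
        (c := c) (F := F) (N := N) isCompact_Icc hy hpos ((continuous_bump z R tc).const_mul k)
        hK0 hK hG (fun r hr hwr => Or.inr ?_) tc ⟨by linarith, by linarith⟩
      have hb := pos_of_mul_pos_right hwr hk.le
      have hr' := mem_Ioo_of_bump_pos hR hb
      refine ⟨hsup r fun s hs => hT _ (by linarith [hs.1, hr'.2]), hsub R le_rfl tc r k hk
        (one_sub_sq_pos_of_bump_pos hb) ?_, Eventually.of_forall hout, fun s _ => hout _⟩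
      have : d z * (r - tc) ≤ 0 := by rw [hdz, zero_mul]
      exact this
    have hb : 0 < bump z R tc tc := by simp [bump, Real.exp_pos]
    have := key (2 * y tc / bump z R tc tc) (div_pos (by linarith [hpos tc]) hb)
    rw [div_mul_cancel₀ _ hb.ne'] at this
    linarith [hpos tc]

end Barrier

section TranslationDichotomy

variable {K u : ℝ → ℝ}

lemma exists_seq_tendsto_ae_comp_sub (hK : Integrable K) {T : Set ℝ} {t : ℝ} (ht : t ∈ closure T) :
    ∃ a : ℕ → T, ∀ᵐ r, Tendsto (fun n => K (a n - r)) atTop (𝓝 (K (t - r))) := by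
  have hk : MemLp (fun r => K (-r)) 1 := memLp_one_iff_integrable.2 hK.comp_neg
  set F : ℝ → Lp ℝ 1 (volume : Measure ℝ) := fun x => DomAddAct.mk (-x) +ᵥ hk.toLp _ with hF
  have hFc : Continuous F := by
    have : Fact ((1 : ENNReal) ≠ ⊤) := ⟨ENNReal.one_ne_top⟩
    have h2 : Continuous fun x : ℝ => DomAddAct.mk (-x) :=
      DomAddAct.continuous_mk.comp continuous_neg
    exact h2.vadd continuous_const
  have hFae : ∀ x, F x =ᵐ[volume] fun r => K (x - r) := fun x => by
    rw [hF]
    simp only [DomAddAct.mk_vadd_toLp]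
    filter_upwards [MemLp.coeFn_toLp (hk.comp_measurePreserving
      (measurePreserving_vadd (-x) (volume : Measure ℝ)))] with r hr
    refine hr.trans ?_
    simp [sub_eq_add_neg, add_comm]
  have : NeBot (comap (Subtype.val : T → ℝ) (𝓝 t)) := by
    rwa [comap_neBot_iff_frequently, Subtype.range_val, ← mem_closure_iff_frequently]
  have htend : Tendsto (fun x : T => F x) (comap Subtype.val (𝓝 t)) (𝓝 (F t)) :=
    (hFc.tendsto t).comp tendsto_comap
  obtain ⟨a, -, ha⟩ := (tendstoInMeasure_of_tendsto_Lp htend).exists_seq_tendsto_ae'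
  refine ⟨a, ?_⟩
  filter_upwards [ha, hFae t, ae_all_iff.2 fun n => hFae (a n)] with r h1 h2 h3
  simpa only [h2, h3] using h1

/-- If the convolution of a kernel with a bounded positive function, not assumed measurable, is
continuous, then either its integrand is always integrable, or the convolution vanishes. -/
lemma integrable_mul_comp_sub_or_integral_eq_zero (hK : Integrable K) (hK0 : ∀ s, 0 ≤ K s)
    (hK1 : ∫ s, K s = 1) {B : ℝ} (hu : ∀ t, 0 < u t) (huB : ∀ t, u t ≤ B)
    (hcont : Continuous fun t => ∫ s, K s * u (t - s)) :
    (∀ t, Integrable fun s => K s * u (t - s)) ∨ ∀ t, ∫ s, K s * u (t - s) = 0 := by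
  set T := {t | Integrable fun s => K s * u (t - s)} with hT
  have hTne : T = {t | ∫ s, K s * u (t - s) ≠ 0} := by
    ext t
    refine ⟨fun ht => ?_, fun ht => by_contra fun h => ht (integral_undef h)⟩
    have hsupp : (Function.support fun s => K s * u (t - s)) = Function.support K := by
      ext s
      simp [(hu (t - s)).ne']
    refine ((integral_pos_iff_support_of_nonneg (fun s => mul_nonneg (hK0 s) (hu _).le) ht).2
      ?_).ne'
    rw [hsupp]
    exact (integral_pos_iff_support_of_nonneg hK0 hK).1 (by rw [hK1]; exact one_pos)
  have hopen : IsOpen T := by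
    rw [hTne]
    exact isOpen_ne.preimage hcont
  have hswap : ∀ t, (Integrable fun s => K s * u (t - s)) ↔
      Integrable fun r => K (t - r) * u r := fun t => by
    rw [← integrable_comp_sub_left (fun r => K (t - r) * u r) t]
    simp
  have hclosed : IsClosed T := by
    refine isClosed_of_closure_subset fun t ht => ?_
    obtain ⟨a, ha⟩ := exists_seq_tendsto_ae_comp_sub hK ht
    have hmeas : AEStronglyMeasurable (fun r => K (t - r) * u r) := by
      refine aestronglyMeasurable_of_tendsto_ae atTop
        (f := fun n r => K (a n - r) * u r)
        (fun n => ((hswap _).1 (a n).2).aestronglyMeasurable) ?_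
      filter_upwards [ha] with r hr
      exact hr.mul_const _
    refine (hswap t).2 (((hK.comp_sub_left t).const_mul B).mono' hmeas (ae_of_all _ fun r => ?_))
    rw [Real.norm_eq_abs, abs_of_nonneg (mul_nonneg (hK0 _) (hu r).le), mul_comm]
    exact mul_le_mul_of_nonneg_right (huB r) (hK0 _)
  rcases isClopen_iff.1 ⟨hclosed, hopen⟩ with h | h
  · exact Or.inr fun t => integral_undef fun ht => (h ▸ (show t ∈ T from ht) : t ∈ (∅ : Set ℝ))
  · exact Or.inl fun t => show t ∈ T from h ▸ mem_univ t

end TranslationDichotomy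

section CharacteristicZero

variable {K : ℝ → ℝ} {c p q : ℝ}

/-- Nonpositivity of all truncated and perturbed characteristic functions somewhere on `[0, ∞)`
produces a positive zero of the characteristic function. -/
lemma exists_char_eq_zero (hK0 : ∀ s, 0 ≤ K s) (hK : Integrable K) (hK1 : ∫ s, K s = 1)
    (hp : 0 < p) (hpq : p < q)
    (H : ∀ᶠ n : ℕ in atTop, ∃ z ≥ 0, z ^ 2 - c * z - (p + 1 / ((n : ℝ) + 1))
      + (q - 1 / ((n : ℝ) + 1)) * ∫ s in Icc (-(n : ℝ)) n, K s * Real.exp (-(z * s)) ≤ 0) :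
    ∃ z > 0, (Integrable fun s => K s * Real.exp (-(z * s))) ∧
      z ^ 2 - c * z - p + q * ∫ s, K s * Real.exp (-(z * s)) = 0 := by
  have hnn : ∀ z s, 0 ≤ K s * Real.exp (-(z * s)) := fun z s => mul_nonneg (hK0 s) (Real.exp_pos _).le
  have hint : ∀ z N : ℝ, IntegrableOn (fun s => K s * Real.exp (-(z * s))) (Icc (-N) N) := by
    intro z N
    simpa using integrableOn_mul_exp hK (p := fun _ => 1) continuous_const z N
  have hcont : ∀ N : ℝ, Continuous fun z : ℝ => ∫ s in Icc (-N) N, K s * Real.exp (-(z * s)) := by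
    intro N
    simpa using continuous_integral_mul_exp hK (p := fun _ => 1) continuous_const N
  have hinv : Tendsto (fun n : ℕ => 1 / ((n : ℝ) + 1)) atTop (𝓝 0) :=
    tendsto_one_div_add_atTop_nhds_zero_nat
  have hsmall : ∀ᶠ n : ℕ in atTop, 1 / ((n : ℝ) + 1) < q := hinv.eventually (gt_mem_nhds (by linarith))
  obtain ⟨n0, hn0⟩ := eventually_atTop.1 (H.and hsmall)
  choose! z hz0 hz using fun n hn => (hn0 n hn).1
  set Z := |c| + p + 2 with hZ
  have hzZ : ∀ n ≥ n0, z n ∈ Icc 0 Z := by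
    intro n hn
    refine ⟨hz0 n hn, ?_⟩
    have h1 := hz n hn
    have h2 : 0 ≤ (q - 1 / ((n : ℝ) + 1)) *
        ∫ s in Icc (-(n : ℝ)) n, K s * Real.exp (-(z n * s)) :=
      mul_nonneg (by linarith [(hn0 n hn).2]) (integral_nonneg fun s => hnn _ s)
    have h3 : 1 / ((n : ℝ) + 1) ≤ 1 := by
      rw [div_le_one (by positivity)]
      linarith [(Nat.cast_nonneg n : (0 : ℝ) ≤ n)]
    have h4 := hz0 n hn
    by_contra! h5
    have h6 := le_abs_self c
    have h7 := abs_nonneg c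
    nlinarith
  obtain ⟨zs, hzs, σ, hσ, hlim⟩ := isCompact_Icc.tendsto_subseq
    (x := fun n => z (n + n0)) fun n => hzZ _ (Nat.le_add_left _ _)
  have hσ' : Tendsto (fun n => σ n + n0) atTop atTop :=
    (tendsto_add_atTop_nat n0).comp hσ.tendsto_atTop
  have hinv' := hinv.comp hσ'
  have hm : ∀ m : ℕ, zs ^ 2 - c * zs - p
      + q * ∫ s in Icc (-(m : ℝ)) m, K s * Real.exp (-(zs * s)) ≤ 0 := by
    intro m
    have h1 : Tendsto (fun n => z (σ n + n0) ^ 2 - c * z (σ n + n0)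
        - (p + 1 / (((σ n + n0 : ℕ) : ℝ) + 1)) + (q - 1 / (((σ n + n0 : ℕ) : ℝ) + 1)) *
        ∫ s in Icc (-(m : ℝ)) m, K s * Real.exp (-(z (σ n + n0) * s))) atTop
        (𝓝 (zs ^ 2 - c * zs - (p + 0) + (q - 0) *
          ∫ s in Icc (-(m : ℝ)) m, K s * Real.exp (-(zs * s)))) := by
      refine (((hlim.pow 2).sub (hlim.const_mul c)).sub (hinv'.const_add p)).add
        ((hinv'.const_sub q).mul ?_)
      exact ((hcont m).tendsto zs).comp hlim
    rw [add_zero, sub_zero] at h1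
    refine le_of_tendsto h1 ?_
    filter_upwards [hσ'.eventually_ge_atTop m] with n hn
    have h2 := hz (σ n + n0) (Nat.le_add_left _ _)
    have h3 := (hn0 (σ n + n0) (Nat.le_add_left _ _)).2
    have h4 : ∫ s in Icc (-(m : ℝ)) m, K s * Real.exp (-(z (σ n + n0) * s)) ≤
        ∫ s in Icc (-((σ n + n0 : ℕ) : ℝ)) ((σ n + n0 : ℕ) : ℝ),
          K s * Real.exp (-(z (σ n + n0) * s)) := by
      have h5 : (m : ℝ) ≤ ((σ n + n0 : ℕ) : ℝ) := Nat.cast_le.2 hn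
      exact setIntegral_mono_set (hint _ _) (ae_of_all _ fun s => hnn _ s)
        (Icc_subset_Icc (neg_le_neg h5) h5).eventuallyLE
    have h5 := mul_le_mul_of_nonneg_left h4 (by linarith :
      0 ≤ q - 1 / (((σ n + n0 : ℕ) : ℝ) + 1))
    linarith
  have hcover : AECover volume atTop fun n : ℕ => Icc (-(n : ℝ)) (n : ℝ) :=
    aecover_Icc (tendsto_neg_atTop_atBot.comp tendsto_natCast_atTop_atTop)
      tendsto_natCast_atTop_atTop
  have hq : 0 < q := hp.trans hpq
  have hKzs : Integrable fun s => K s * Real.exp (-(zs * s)) := by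
    refine hcover.integrable_of_integral_bounded_of_nonneg_ae ((p + c * zs - zs ^ 2) / q)
      (fun n => hint zs n) (ae_of_all _ fun s => hnn _ s) (Eventually.of_forall fun m => ?_)
    rw [le_div_iff₀ hq]
    linarith [hm m]
  have hchi : zs ^ 2 - c * zs - p + q * ∫ s, K s * Real.exp (-(zs * s)) ≤ 0 :=
    le_of_tendsto (((hcover.integral_tendsto_of_countably_generated hKzs).const_mul q).const_add
      (zs ^ 2 - c * zs - p)) (Eventually.of_forall hm)
  have hdom : ∀ w ∈ Icc 0 zs, ∀ s, K s * Real.exp (-(w * s)) ≤ K s + K s * Real.exp (-(zs * s)) := by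
    intro w hw s
    rw [← mul_one_add]
    refine mul_le_mul_of_nonneg_left ?_ (hK0 s)
    rcases le_total 0 s with h | h
    · linarith [Real.exp_le_one_iff.2 (by nlinarith [hw.1] : -(w * s) ≤ 0),
        Real.exp_pos (-(zs * s))]
    · linarith [Real.exp_le_exp.2 (by nlinarith [hw.2] : -(w * s) ≤ -(zs * s))]
  have hmeas : ∀ w : ℝ, AEStronglyMeasurable fun s => K s * Real.exp (-(w * s)) := fun w =>
    hK.aestronglyMeasurable.mul (by fun_prop : Continuous fun s =>
      Real.exp (-(w * s))).aestronglyMeasurable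
  have hnorm : ∀ w ∈ Icc 0 zs, ∀ s, ‖K s * Real.exp (-(w * s))‖ ≤
      K s + K s * Real.exp (-(zs * s)) := fun w hw s => by
    rw [Real.norm_eq_abs, abs_of_nonneg (hnn w s)]
    exact hdom w hw s
  have hcontOn : ContinuousOn (fun w => w ^ 2 - c * w - p + q * ∫ s, K s * Real.exp (-(w * s)))
      (Icc 0 zs) := by
    have : ContinuousOn (fun w => ∫ s, K s * Real.exp (-(w * s))) (Icc 0 zs) :=
      continuousOn_of_dominated (fun w _ => hmeas w) (fun w hw => ae_of_all _ (hnorm w hw))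
        (hK.add hKzs) (ae_of_all _ fun s => by fun_prop)
    fun_prop
  have hchi0 : (0 : ℝ) ^ 2 - c * 0 - p + q * ∫ s, K s * Real.exp (-(0 * s)) = q - p := by
    simp only [zero_mul, neg_zero, Real.exp_zero, mul_one, hK1]
    ring
  obtain ⟨w, hw, hw0⟩ := intermediate_value_Icc' hzs.1 hcontOn
    ⟨hchi, by simp only [hchi0]; linarith⟩
  refine ⟨w, lt_of_le_of_ne hw.1 ?_, (hK.add hKzs).mono' (hmeas w) (ae_of_all _ (hnorm w hw)), hw0⟩
  rintro rfl
  simp only [hchi0] at hw0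
  linarith

end CharacteristicZero

section SemiWavefront

variable {f g y K : ℝ → ℝ} {c p q M : ℝ}

lemma eventually_le_mul_of_tendsto_div {f : ℝ → ℝ} {p F : ℝ}
    (hf : Tendsto (fun s => f s / s) (𝓝[>] 0) (𝓝 p)) (hF : p < F) :
    ∀ᶠ x in 𝓝[>] (0 : ℝ), f x ≤ F * x := by
  filter_upwards [hf.eventually (gt_mem_nhds hF), self_mem_nhdsWithin] with x hx hx0
  exact ((div_lt_iff₀ hx0).1 hx).le

lemma eventually_mul_le_of_tendsto_div {g : ℝ → ℝ} {q G : ℝ}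
    (hg : Tendsto (fun s => g s / s) (𝓝[>] 0) (𝓝 q)) (hG : G < q) :
    ∀ᶠ x in 𝓝[>] (0 : ℝ), G * x ≤ g x := by
  filter_upwards [hg.eventually (lt_mem_nhds hG), self_mem_nhdsWithin] with x hx hx0
  exact ((lt_div_iff₀ hx0).1 hx).le

/-- Where a solution is small it is a supersolution of a truncated perturbation of the
linearization at zero. -/
lemma exists_supersolAt_of_lt (hf' : Tendsto (fun s => f s / s) (𝓝[>] 0) (𝓝 p))
    (hg' : Tendsto (fun s => g s / s) (𝓝[>] 0) (𝓝 q)) (hgnn : ∀ s, 0 ≤ s → 0 ≤ g s)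
    (hK : Integrable K) (hK0 : ∀ s, 0 ≤ K s) (hy : Continuous y) (hpos : ∀ t, 0 < y t)
    (hint : ∀ t, Integrable fun s => K s * g (y (t - s)))
    (heq : ∀ t, deriv (deriv y) t - c * deriv y t - f (y t) + ∫ s, K s * g (y (t - s)) = 0)
    {δ N : ℝ} (hδ : 0 < δ) (hN : 0 ≤ N) :
    ∃ η > 0, ∀ t, (∀ s ∈ Icc (-N) N, y (t - s) < η) → SupersolAt c (p + δ) (q - δ) K N y t := by
  have hev := (eventually_le_mul_of_tendsto_div hf' (lt_add_of_pos_right p hδ)).and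
    (eventually_mul_le_of_tendsto_div hg' (sub_lt_self q hδ))
  obtain ⟨η, hη, hη'⟩ := mem_nhdsGT_iff_exists_Ioo_subset.1 hev
  refine ⟨η, hη, fun t ht => ?_⟩
  have h1 : f (y t) ≤ (p + δ) * y t :=
    (hη' ⟨hpos t, by simpa using ht 0 ⟨by linarith, hN⟩⟩).1
  have h2 : (q - δ) * truncConv K N y t ≤ ∫ s in Icc (-N) N, K s * g (y (t - s)) := by
    rw [truncConv, ← integral_const_mul]
    refine setIntegral_mono_on ((integrableOn_mul_comp_sub hK hy N t).const_mul _)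
      (hint t).integrableOn measurableSet_Icc fun s hs => ?_
    have := mul_le_mul_of_nonneg_left (hη' ⟨hpos (t - s), ht s hs⟩).2 (hK0 s)
    linarith
  have h3 : ∫ s in Icc (-N) N, K s * g (y (t - s)) ≤ ∫ s, K s * g (y (t - s)) :=
    setIntegral_le_integral (hint t) (ae_of_all _ fun s =>
      mul_nonneg (hK0 s) (hgnn _ (hpos _).le))
  have := heq t
  rw [SupersolAt]
  linarith

/-- A positive bounded solution with zero lower limit at `-∞` vanishes there, and the
characteristic function at zero has a positive root. -/
lemma tendsto_zero_and_exists_char_eq_zero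
    (hflip : ∃ L : NNReal, LipschitzOnWith L f (Icc 0 M)) (hfmono : StrictMonoOn f (Ici 0))
    (hf0 : f 0 = 0) (hgpos : ∀ t, 0 < t → 0 < g t) (hgnn : ∀ s, 0 ≤ s → 0 ≤ g s)
    (hgbdd : BddAbove (g '' Ici 0))
    (hf' : Tendsto (fun s => f s / s) (𝓝[>] 0) (𝓝 p))
    (hg' : Tendsto (fun s => g s / s) (𝓝[>] 0) (𝓝 q)) (hp : 0 < p) (hpq : p < q)
    (hK : Integrable K) (hK0 : ∀ s, 0 ≤ K s) (hK1 : ∫ s, K s = 1)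
    (hy : ContDiff ℝ 2 y) (hpos : ∀ t, 0 < y t) (hM : ∀ t, y t ≤ M)
    (heq : ∀ t, deriv (deriv y) t - c * deriv y t - f (y t) + ∫ s, K s * g (y (t - s)) = 0)
    (hlim : liminf y atBot = 0) :
    Tendsto y atBot (𝓝 0) ∧ ∃ z > 0, (Integrable fun s => K s * Real.exp (-(z * s))) ∧
      z ^ 2 - c * z - p + q * ∫ s, K s * Real.exp (-(z * s)) = 0 := by
  obtain ⟨L, hL⟩ := hflip
  obtain ⟨B, hB⟩ := hgbdd
  have hmem : ∀ t, y t ∈ Icc 0 M := fun t => ⟨(hpos t).le, hM t⟩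
  have hfy : Continuous fun t => f (y t) := hL.continuousOn.comp_continuous hy.continuous hmem
  have hint : ∀ t, Integrable fun s => K s * g (y (t - s)) := by
    refine (integrable_mul_comp_sub_or_integral_eq_zero (u := fun t => g (y t)) (B := B) hK hK0 hK1
      (fun t => hgpos _ (hpos t)) (fun t => hB ⟨y t, (hpos t).le, rfl⟩) ?_).resolve_right
      fun h0 => not_bounded_of_local_eq (c := c) hy hpos hM hfmono hf0 fun t => ?_
    · have h1 : Continuous (deriv y) := hy.contDiff_deriv_two.continuous
      have h2 : Continuous (deriv (deriv y)) := hy.contDiff_deriv_two.continuous_deriv le_rfl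
      have : (fun t => ∫ s, K s * g (y (t - s))) =
          fun t => f (y t) - deriv (deriv y) t + c * deriv y t :=
        funext fun t => by linarith [heq t]
      rw [this]
      exact (hfy.sub h2).add (h1.const_mul c)
    · have h1 := heq t
      have h2 := h0 t
      linarith
  have hloc : ∀ t, deriv (deriv y) t - c * deriv y t - (L : ℝ) * y t ≤ 0 := fun t => by
    have h1 : f (y t) ≤ L * y t := by
      have := hL.dist_le_mul (y t) (hmem t) 0 ⟨le_rfl, (hmem t).1.trans (hmem t).2⟩
      rw [Real.dist_eq, Real.dist_eq, hf0, sub_zero, sub_zero, abs_of_pos (hpos t)] at this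
      exact (le_abs_self _).trans this
    have h2 : 0 ≤ ∫ s, K s * g (y (t - s)) :=
      integral_nonneg fun s => mul_nonneg (hK0 s) (hgnn _ (hpos _).le)
    linarith [heq t]
  have hsup : ∀ n : ℕ, ∃ η > 0, ∀ t, (∀ s ∈ Icc (-(n : ℝ)) n, y (t - s) < η) →
      SupersolAt c (p + 1 / ((n : ℝ) + 1)) (q - 1 / ((n : ℝ) + 1)) K n y t := fun n =>
    exists_supersolAt_of_lt hf' hg' hgnn hK hK0 hy.continuous hpos hint heq
      Nat.one_div_pos_of_nat n.cast_nonneg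
  have hinv : Tendsto (fun n : ℕ => 1 / ((n : ℝ) + 1)) atTop (𝓝 0) :=
    tendsto_one_div_add_atTop_nhds_zero_nat
  have hsmall : ∀ᶠ n : ℕ in atTop, 1 / ((n : ℝ) + 1) < q :=
    hinv.eventually (gt_mem_nhds (by linarith))
  have htend : Tendsto y atBot (𝓝 0) := by
    have hcover : AECover volume atTop fun n : ℕ => Icc (-(n : ℝ)) (n : ℝ) :=
      aecover_Icc (tendsto_neg_atTop_atBot.comp tendsto_natCast_atTop_atTop)
        tendsto_natCast_atTop_atTop
    have hchi : Tendsto (fun n : ℕ => (0 : ℝ) ^ 2 - c * 0 - (p + 1 / ((n : ℝ) + 1))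
        + (q - 1 / ((n : ℝ) + 1)) * ∫ s in Icc (-(n : ℝ)) n, K s * Real.exp (-(0 * s))) atTop
        (𝓝 ((0 : ℝ) ^ 2 - c * 0 - (p + 0) + (q - 0) * 1)) := by
      refine ((hinv.const_add p).const_sub _).add ((hinv.const_sub q).mul ?_)
      simpa [hK1] using hcover.integral_tendsto_of_countably_generated hK
    obtain ⟨n, hn1, hn2⟩ := ((hchi.eventually (lt_mem_nhds (a := 0) (by linarith))).and
      hsmall).exists
    obtain ⟨η, hη, hηs⟩ := hsup n
    exact tendsto_zero_of_liminf hy hpos L.coe_nonneg hloc hK0 hK (sub_nonneg.2 hn2.le)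
      n.cast_nonneg hη hηs hn1 ⟨M, hM⟩ hlim
  refine ⟨htend, exists_char_eq_zero hK0 hK hK1 hp hpq ?_⟩
  filter_upwards [hsmall] with n hn
  obtain ⟨η, hη, hηs⟩ := hsup n
  exact exists_char_nonpos_of_tendsto_zero hy hpos L.coe_nonneg hloc hK0 hK (sub_nonneg.2 hn.le)
    n.cast_nonneg hη hηs htend

end SemiWavefront

theorem stmt19
    (f g : ℝ → ℝ) (f'0 g'0 : ℝ) (K : ℝ → ℝ) (h : ℝ) (hh : 0 ≤ h)
    (hflip : ∀ R : ℝ, 0 < R → ∃ L : NNReal, LipschitzOnWith L f (Icc 0 R))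
    (hfmono : StrictMonoOn f (Ici 0))
    (hf0 : f 0 = 0) (hg0 : g 0 = 0)
    (hfnn : ∀ s, 0 ≤ s → 0 ≤ f s) (hgnn : ∀ s, 0 ≤ s → 0 ≤ g s)
    (hf' : Tendsto (fun s => f s / s) (𝓝[>] 0) (𝓝 f'0))
    (hg' : Tendsto (fun s => g s / s) (𝓝[>] 0) (𝓝 g'0))
    (hf'0 : 0 < f'0) (hf'g' : f'0 < g'0)
    (hgpos : ∀ t : ℝ, 0 < t → 0 < g t)
    (hgbdd : BddAbove (g '' Ici 0))
    (hsupf : ∃ ζ : ℝ, 0 < ζ ∧ sSup (g '' Ici 0) < f ζ)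
    (hKm : Measurable K) (hKnn : ∀ s, 0 ≤ K s)
    (hKint : Integrable K) (hKnorm : (∫ s, K s) = 1)
    (a b : EReal) (ha : a < 0) (hb : 0 < b)
    (hdom : ∀ z : ℝ, (Integrable (fun s => K s * Real.exp (-(z * s)))) ↔ (a < (z:EReal) ∧ (z:EReal) < b))
    (cm cp : EReal) (hcmcp : cm < cp)
    (hcrit : ∀ c : ℝ,
      (∃ z : ℝ, (Integrable (fun s => K s * Real.exp (-(z * s)))) ∧ (fun z c : ℝ => z ^ 2 - c * z - f'0 + g'0 * Real.exp (-(z * c * h)) * ∫ s, K s * Real.exp (-(z * s))) z c = 0) ↔ ((c:EReal) ≤ cm ∨ cp ≤ (c:EReal)))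
    (hsign : ∀ c z : ℝ, (Integrable (fun s => K s * Real.exp (-(z * s)))) → (fun z c : ℝ => z ^ 2 - c * z - f'0 + g'0 * Real.exp (-(z * c * h)) * ∫ s, K s * Real.exp (-(z * s))) z c = 0 →
      (cp ≤ (c:EReal) → 0 < z) ∧ ((c:EReal) ≤ cm → z < 0))
    (c : ℝ) (φ : ℝ → ℝ) (hφC2 : ContDiff ℝ 2 φ)
    (hφpos : ∀ t, 0 < φ t) (hφbd : ∃ M, ∀ t, φ t ≤ M)
    (hφeq : ∀ t, deriv (deriv φ) t - c * deriv φ t - f (φ t)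
      + (∫ s, K s * g (φ (t - s - c * h))) = 0) :
    (liminf φ atBot = 0 → Tendsto φ atBot (𝓝 0) ∧ cp ≠ ⊤ ∧ cp ≤ (c:EReal)) ∧
    (liminf φ atTop = 0 → Tendsto φ atTop (𝓝 0) ∧ cm ≠ ⊥ ∧ (c:EReal) ≤ cm) ∧
    ¬(Tendsto φ atBot (𝓝 0) ∧ Tendsto φ atTop (𝓝 0)) ∧
    (cm < (c:EReal) ∧ (c:EReal) < cp →
      ¬(Tendsto φ atBot (𝓝 0) ∨ Tendsto φ atTop (𝓝 0))) := by
  obtain ⟨M, hM⟩ := hφbd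
  have hMpos : 0 < M := (hφpos 0).trans_le (hM 0)
  set d := c * h with hd
  have hshift : ∀ z : ℝ, (Integrable fun s => K (s - d) * Real.exp (-(z * s))) →
      Integrable fun s => K s * Real.exp (-(z * s)) := fun z hz => by
    have h1 := (hz.comp_add_right d).mul_const (Real.exp (z * d))
    refine h1.congr (ae_of_all _ fun s => ?_)
    simp only [add_sub_cancel_right]
    rw [mul_assoc, ← Real.exp_add]
    ring_nf
  have hshift_int : ∀ z : ℝ, ∫ s, K (s - d) * Real.exp (-(z * s)) =
      Real.exp (-(z * c * h)) * ∫ s, K s * Real.exp (-(z * s)) := fun z => by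
    rw [← integral_add_right_eq_self _ d, ← integral_const_mul]
    congr 1
    funext s
    rw [add_sub_cancel_right, mul_left_comm, ← Real.exp_add, hd]
    ring_nf
  have hzero : ∀ z : ℝ, (Integrable fun s => K (s - d) * Real.exp (-(z * s))) →
      z ^ 2 - c * z - f'0 + g'0 * ∫ s, K (s - d) * Real.exp (-(z * s)) = 0 →
      ((c : EReal) ≤ cm ∨ cp ≤ c) ∧ (cp ≤ (c : EReal) → 0 < z) ∧ ((c : EReal) ≤ cm → z < 0) := by
    intro z hz1 hz2
    replace hz1 := hshift z hz1
    rw [hshift_int, ← mul_assoc] at hz2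
    exact ⟨(hcrit c).1 ⟨z, hz1, hz2⟩, hsign c z hz1 hz2⟩
  have hconv : ∀ t, ∫ s, K (s - d) * g (φ (t - s)) = ∫ s, K s * g (φ (t - s - d)) := fun t => by
    rw [← integral_add_right_eq_self _ d]
    simp only [add_sub_cancel_right, sub_add_eq_sub_sub]
  have hbot : liminf φ atBot = 0 → Tendsto φ atBot (𝓝 0) ∧ cp ≠ ⊤ ∧ cp ≤ (c:EReal) := by
    intro hl
    obtain ⟨h1, z, hz, hz1, hz2⟩ := tendsto_zero_and_exists_char_eq_zero (K := fun s => K (s - d))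
      (c := c) (hflip M hMpos) hfmono hf0 hgpos hgnn hgbdd hf' hg' hf'0 hf'g'
      (hKint.comp_sub_right d) (fun s => hKnn _)
      (by rw [integral_sub_right_eq_self K d, hKnorm]) hφC2 hφpos hM
      (fun t => by rw [hconv]; exact hφeq t) hl
    obtain ⟨h3, -, h4⟩ := hzero z hz1 hz2
    have h5 : cp ≤ (c : EReal) := h3.resolve_left fun h' => absurd (h4 h') (not_lt.2 hz.le)
    exact ⟨h1, (h5.trans_lt (EReal.coe_lt_top c)).ne, h5⟩
  have htop : liminf φ atTop = 0 → Tendsto φ atTop (𝓝 0) ∧ cm ≠ ⊥ ∧ (c:EReal) ≤ cm := by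
    intro hl
    have hl' : liminf (fun t => φ (-t)) atBot = 0 := by
      rw [← hl, ← map_neg_atBot]
      rfl
    obtain ⟨h1, z, hz, hz1, hz2⟩ := tendsto_zero_and_exists_char_eq_zero
      (K := fun s => K (-s - d)) (y := fun t => φ (-t))
      (c := -c) (hflip M hMpos) hfmono hf0 hgpos hgnn hgbdd hf' hg' hf'0 hf'g'
      (hKint.comp_sub_right d).comp_neg (fun s => hKnn _)
      (by rw [integral_neg_eq_self (fun s => K (s - d)), integral_sub_right_eq_self K d, hKnorm])
      (hφC2.comp contDiff_neg) (fun t => hφpos _) (fun t => hM _)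
      (fun t => by
        rw [deriv_deriv_comp_neg, deriv_comp_neg_fun,
          ← integral_neg_eq_self (fun s => K (-s - d) * g (φ (-(t - s))))]
        have h2 := hφeq (-t)
        rw [← hconv] at h2
        simp only [neg_neg, neg_sub]
        simp only [show ∀ s, -s - t = -t - s from fun s => by ring]
        linarith) hl'
    have hz1' : Integrable fun s => K (s - d) * Real.exp (-(-z * s)) := by
      simpa using hz1.comp_neg
    rw [← integral_neg_eq_self (fun s => K (-s - d) * Real.exp (-(z * s)))] at hz2
    obtain ⟨h3, h4, -⟩ := hzero (-z) hz1' (by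
      simp only [neg_neg, mul_neg, neg_mul] at hz2 ⊢
      linarith [neg_sq z])
    have h5 : (c : EReal) ≤ cm :=
      h3.resolve_right fun h' => absurd (h4 h') (not_lt.2 (neg_nonpos.2 hz.le))
    refine ⟨?_, ((EReal.bot_lt_coe c).trans_le h5).ne', h5⟩
    have := h1.comp tendsto_neg_atTop_atBot
    simpa [Function.comp_def] using this
  refine ⟨hbot, htop, fun ⟨h1, h2⟩ => ?_, fun ⟨h1, h2⟩ h3 => ?_⟩
  · exact absurd ((hbot h1.liminf_eq).2.2.trans (htop h2.liminf_eq).2.2) (not_le.2 hcmcp)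
  · rcases h3 with h3 | h3
    · exact absurd (hbot h3.liminf_eq).2.2 (not_le.2 h2)
    · exact absurd (htop h3.liminf_eq).2.2 (not_le.2 h1)
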